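/- For every T ∈ R(V) the Schouten-type tensor of T decomposes with respect to u as: Sch(T) = (1/(n−2)) (ε T̂^⊥ + hat(Ric(T^∥))) + (Scal(T^∥)/(2(n−1)(n−2))) γ − (2ε/(n−2)) u ⊗_s V_tr + (1/(n−1)) (Z_tr − ε Scal(T^∥)/(2(n−2))) u⊗u. -/

import Mathlib

open scoped BigOperators

noncomputable section

namespace Decomp

abbrev Vec (n : ℕ) := Fin n → ℝ
abbrev Ten2 (n : ℕ) := Fin n → Fin n → ℝ
abbrev Ten3 (n : ℕ) := Fin n → Fin n → Fin n → ℝ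
abbrev Ten4 (n : ℕ) := Fin n → Fin n → Fin n → Fin n → ℝ

variable {n : ℕ}

/-- A (0,4)-tensor with the algebraic symmetries of a Riemann tensor. -/
def IsRiemannType (T : Ten4 n) : Prop :=
  (∀ α β μ ν, T α β μ ν = - T α β ν μ) ∧
  (∀ α β μ ν, T α β μ ν = - T β α μ ν) ∧
  (∀ α β μ ν, T α β μ ν = T μ ν α β) ∧
  (∀ α β μ ν, T α β μ ν + T α μ ν β + T α ν β μ = 0)

/-- A (0,3)-tensor antisymmetric in the last two indices with vanishing cyclic sum. -/
def IsLambda12 (F : Ten3 n) : Prop :=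
  (∀ α μ ν, F α μ ν = - F α ν μ) ∧
  (∀ α μ ν, F α μ ν + F μ ν α + F ν α μ = 0)

def IsSym2 (S : Ten2 n) : Prop := ∀ α β, S α β = S β α

/-- Ricci-type trace of a (0,4)-tensor (first and third indices, using the inverse metric). -/
def RicT (ginv : Ten2 n) (T : Ten4 n) : Ten2 n :=
  fun β ν => ∑ α, ∑ μ, ginv α μ * T α β μ ν

/-- Scalar-type trace. -/
def ScalT (ginv : Ten2 n) (T : Ten4 n) : ℝ :=
  ∑ β, ∑ ν, ginv β ν * RicT ginv T β ν

/-- Weyl-type: Riemann-type and trace-free in the first and third indices. -/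
def IsWeylType (ginv : Ten2 n) (T : Ten4 n) : Prop :=
  IsRiemannType T ∧ ∀ β ν, RicT ginv T β ν = 0

/-- Kulkarni–Nomizu product. -/
def KN (A B : Ten2 n) : Ten4 n := fun α β μ ν =>
  A α μ * B β ν - A α ν * B β μ - A β μ * B α ν + A β ν * B α μ

/-- (u ⊛ F) for a one-form w and F ∈ Λ^{(1,2)}. -/
def circ (w : Vec n) (F : Ten3 n) : Ten4 n := fun α β μ ν =>
  w α * F β μ ν - w β * F α μ ν + w μ * F ν α β - w ν * F μ α β

/-- Lower an index with the metric. -/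
def lower (g : Ten2 n) (u : Vec n) : Vec n := fun α => ∑ β, g α β * u β

/-- Projector orthogonal to `u`, both indices covariant: γ_{αβ} = g_{αβ} − ε u_α u_β. -/
def gam (g : Ten2 n) (ε : ℝ) (u : Vec n) : Ten2 n := fun α β =>
  g α β - ε * lower g u α * lower g u β

/-- Mixed projector γ^κ_μ = δ^κ_μ − ε u^κ u_μ. -/
def gamMix (g : Ten2 n) (ε : ℝ) (u : Vec n) : Ten2 n := fun κ μ =>
  (if κ = μ then (1 : ℝ) else 0) - ε * u κ * lower g u μ

/-- Contravariant projector γ^{αβ} = g^{αβ} − ε u^α u^β. -/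
def gamUp (ginv : Ten2 n) (ε : ℝ) (u : Vec n) : Ten2 n := fun α β =>
  ginv α β - ε * u α * u β

/-- η := u⊗u − (ε/(n−3)) γ. -/
def eta (g : Ten2 n) (ε : ℝ) (u : Vec n) : Ten2 n := fun α β =>
  lower g u α * lower g u β - (ε / ((n : ℝ) - 3)) * gam g ε u α β

/-- T^⊥_{βν} := u^α u^μ T_{αβμν}. -/
def perp (u : Vec n) (T : Ten4 n) : Ten2 n := fun β ν =>
  ∑ α, ∑ μ, u α * u μ * T α β μ ν

/-- T^{⊥∥}_{βμν} := u^α γ^κ_μ γ^σ_ν T_{αβκσ}. -/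
def perppar (g : Ten2 n) (ε : ℝ) (u : Vec n) (T : Ten4 n) : Ten3 n := fun β μ ν =>
  ∑ α, ∑ κ, ∑ σ, u α * gamMix g ε u κ μ * gamMix g ε u σ ν * T α β κ σ

/-- T^∥ : projection of T with γ in all four indices. -/
def par4 (g : Ten2 n) (ε : ℝ) (u : Vec n) (T : Ten4 n) : Ten4 n := fun α β μ ν =>
  ∑ ρ, ∑ σ, ∑ κ, ∑ δ,
    gamMix g ε u ρ α * gamMix g ε u σ β * gamMix g ε u κ μ * gamMix g ε u δ ν * T ρ σ κ δ

/-- T^{∥u} := T^∥ + (ε/(n−3)) T^⊥ ∧ γ. -/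
def parU (g : Ten2 n) (ε : ℝ) (u : Vec n) (T : Ten4 n) : Ten4 n := fun α β μ ν =>
  par4 g ε u T α β μ ν + (ε / ((n : ℝ) - 3)) * KN (perp u T) (gam g ε u) α β μ ν

/-- Complete orthogonality to `u` for (0,2)-tensors. -/
def Orth2 (u : Vec n) (S : Ten2 n) : Prop :=
  (∀ β, (∑ α, u α * S α β) = 0) ∧ (∀ β, (∑ α, u α * S β α) = 0)

/-- Complete orthogonality to `u` for (0,3)-tensors. -/
def Orth3 (u : Vec n) (F : Ten3 n) : Prop :=
  (∀ μ ν, (∑ α, u α * F α μ ν) = 0) ∧ (∀ μ ν, (∑ α, u α * F μ α ν) = 0) ∧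
    (∀ μ ν, (∑ α, u α * F μ ν α) = 0)

/-- Complete orthogonality to `u` for (0,4)-tensors. -/
def Orth4 (u : Vec n) (T : Ten4 n) : Prop :=
  (∀ β μ ν, (∑ α, u α * T α β μ ν) = 0) ∧ (∀ β μ ν, (∑ α, u α * T β α μ ν) = 0) ∧
    (∀ β μ ν, (∑ α, u α * T β μ α ν) = 0) ∧ (∀ β μ ν, (∑ α, u α * T β μ ν α) = 0)

/-- tr_γ of a (0,2)-tensor. -/
def trGam (ginv : Ten2 n) (ε : ℝ) (u : Vec n) (S : Ten2 n) : ℝ :=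
  ∑ α, ∑ β, gamUp ginv ε u α β * S α β

/-- Schouten-type tensor of a (0,4)-tensor. -/
def SchT (g ginv : Ten2 n) (T : Ten4 n) : Ten2 n := fun β ν =>
  (1 / ((n : ℝ) - 2)) * (RicT ginv T β ν - ScalT ginv T / (2 * ((n : ℝ) - 1)) * g β ν)

/-- Weyl-type part of a (0,4)-tensor: Weyl(T) := T − Sch(T) ∧ g. -/
def WeylT (g ginv : Ten2 n) (T : Ten4 n) : Ten4 n := fun α β μ ν =>
  T α β μ ν - KN (SchT g ginv T) g α β μ ν

/-- Sch_u for Riemann-type tensors completely orthogonal to u. -/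
def SchU (g ginv : Ten2 n) (ε : ℝ) (u : Vec n) (P : Ten4 n) : Ten2 n := fun β ν =>
  (1 / ((n : ℝ) - 3)) * (RicT ginv P β ν - ScalT ginv P / (2 * ((n : ℝ) - 2)) * gam g ε u β ν)

/-- Weyl_u for Riemann-type tensors completely orthogonal to u. -/
def WeylU (g ginv : Ten2 n) (ε : ℝ) (u : Vec n) (P : Ten4 n) : Ten4 n := fun α β μ ν =>
  P α β μ ν - KN (SchU g ginv ε u P) (gam g ε u) α β μ ν

/-- Z_tr := tr_γ T^⊥. -/
def Ztr (ginv : Ten2 n) (ε : ℝ) (u : Vec n) (T : Ten4 n) : ℝ :=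
  trGam ginv ε u (perp u T)

/-- γ-trace-free part of an orthogonal symmetric (0,2)-tensor. -/
def hat2 (g ginv : Ten2 n) (ε : ℝ) (u : Vec n) (S : Ten2 n) : Ten2 n := fun β ν =>
  S β ν - trGam ginv ε u S / ((n : ℝ) - 1) * gam g ε u β ν

/-- T̂^⊥ := T^⊥ − (Z_tr/(n−1)) γ. -/
def hatPerp (g ginv : Ten2 n) (ε : ℝ) (u : Vec n) (T : Ten4 n) : Ten2 n :=
  hat2 g ginv ε u (perp u T)

/-- (V_tr)_μ := γ^{αβ} T^{⊥∥}_{αβμ}. -/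
def Vtr (g ginv : Ten2 n) (ε : ℝ) (u : Vec n) (T : Ten4 n) : Vec n := fun μ =>
  ∑ α, ∑ β, gamUp ginv ε u α β * perppar g ε u T α β μ

/-- T̂^{⊥∥}_{αβμ} := T^{⊥∥}_{αβμ} + (1/(n−2))(−γ_{αβ}(V_tr)_μ + γ_{αμ}(V_tr)_β). -/
def hatPerppar (g ginv : Ten2 n) (ε : ℝ) (u : Vec n) (T : Ten4 n) : Ten3 n := fun α β μ =>
  perppar g ε u T α β μ + (1 / ((n : ℝ) - 2)) *
    (- gam g ε u α β * Vtr g ginv ε u T μ + gam g ε u α μ * Vtr g ginv ε u T β)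

/-- S^∥_{βν} := γ^ρ_β γ^κ_ν S_{ρκ}. -/
def s2par (g : Ten2 n) (ε : ℝ) (u : Vec n) (S : Ten2 n) : Ten2 n := fun β ν =>
  ∑ ρ, ∑ κ, gamMix g ε u ρ β * gamMix g ε u κ ν * S ρ κ

/-- S^{⊥∥}_β := γ^ρ_β u^κ S_{ρκ}. -/
def s2perppar (g : Ten2 n) (ε : ℝ) (u : Vec n) (S : Ten2 n) : Vec n := fun β =>
  ∑ ρ, ∑ κ, gamMix g ε u ρ β * u κ * S ρ κ

/-- S^⊥ := u^ρ u^κ S_{ρκ}. -/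
def s2perp (u : Vec n) (S : Ten2 n) : ℝ := ∑ ρ, ∑ κ, u ρ * u κ * S ρ κ

/-- σ^{(2)}_{βν} := σ_{βρ} σ^ρ{}_ν. -/
def sq (ginv : Ten2 n) (σ : Ten2 n) : Ten2 n := fun β ν =>
  ∑ ρ, ∑ κ, σ β ρ * ginv ρ κ * σ κ ν

/-- Mixed projector h^μ_{μ'} = γ^μ_{μ'} + ε y^μ y_{μ'} orthogonal to span{u,y}. -/
def hMix (g : Ten2 n) (ε : ℝ) (u y : Vec n) : Ten2 n := fun μ μ' =>
  gamMix g ε u μ μ' + ε * y μ * lower g y μ'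

/-- Covariant projector h_{αβ} = γ_{αβ} + ε y_α y_β. -/
def hCov (g : Ten2 n) (ε : ℝ) (u y : Vec n) : Ten2 n := fun α β =>
  gam g ε u α β + ε * lower g y α * lower g y β

/-- g is a symmetric nondegenerate bilinear form with (symmetric) inverse ginv. -/
def GoodMetric (g ginv : Ten2 n) : Prop :=
  (∀ α β, g α β = g β α) ∧ (∀ α β, ginv α β = ginv β α) ∧
    (∀ α β, (∑ μ, ginv α μ * g μ β) = if α = β then (1 : ℝ) else 0) ∧
    (∀ α β, (∑ μ, g α μ * ginv μ β) = if α = β then (1 : ℝ) else 0)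

/-- u is a unit vector with g(u,u) = ε ∈ {−1,1}. -/
def UnitVec (g : Ten2 n) (ε : ℝ) (u : Vec n) : Prop :=
  (ε = 1 ∨ ε = -1) ∧ (∑ α, ∑ β, g α β * u α * u β) = ε


lemma sum_six_reorder {ι : Type*} [Fintype ι] (f : ι → ι → ι → ι → ι → ι → ℝ) :
    ∑ α, ∑ μ, ∑ ρ, ∑ σ, ∑ κ, ∑ δ, f α μ ρ σ κ δ =
      ∑ σ, ∑ δ, ∑ ρ, ∑ κ, ∑ α, ∑ μ, f α μ ρ σ κ δ := by
  let e : (ι × ι × ι × ι × ι × ι) ≃ (ι × ι × ι × ι × ι × ι) :=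
    { toFun := fun p => (p.2.2.2.2.1, p.2.2.2.2.2, p.2.2.1, p.1, p.2.2.2.1, p.2.1)
      invFun := fun p => (p.2.2.2.1, p.2.2.2.2.2, p.2.2.1, p.2.2.2.2.1, p.1, p.2.1)
      left_inv := fun _ => rfl
      right_inv := fun _ => rfl }
  have h := Equiv.sum_comp e (fun p => f p.1 p.2.1 p.2.2.1 p.2.2.2.1 p.2.2.2.2.1 p.2.2.2.2.2)
  simp only [Fintype.sum_prod_type] at h
  exact h.symm

lemma sum_five_reorder {ι : Type*} [Fintype ι] (f : ι → ι → ι → ι → ι → ℝ) :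
    ∑ α, ∑ β, ∑ ρ, ∑ κ, ∑ σ, f α β ρ κ σ = ∑ σ, ∑ ρ, ∑ α, ∑ κ, ∑ β, f α β ρ κ σ := by
  let e : (ι × ι × ι × ι × ι) ≃ (ι × ι × ι × ι × ι) :=
    { toFun := fun p => (p.2.2.1, p.2.2.2.2, p.2.1, p.2.2.2.1, p.1)
      invFun := fun p => (p.2.2.2.2, p.2.2.1, p.1, p.2.2.2.1, p.2.1)
      left_inv := fun _ => rfl
      right_inv := fun _ => rfl }
  have h := Equiv.sum_comp e (fun p => f p.1 p.2.1 p.2.2.1 p.2.2.2.1 p.2.2.2.2)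
  simp only [Fintype.sum_prod_type] at h
  exact h.symm

lemma sum_four_reorder {ι : Type*} [Fintype ι] (f : ι → ι → ι → ι → ℝ) :
    ∑ α, ∑ β, ∑ μ, ∑ ν, f α β μ ν = ∑ μ, ∑ ν, ∑ α, ∑ β, f α β μ ν := by
  have h := Equiv.sum_comp (Equiv.prodComm (ι × ι) (ι × ι))
    (fun p => f p.1.1 p.1.2 p.2.1 p.2.2)
  simp only [Fintype.sum_prod_type] at h
  exact h.symm

lemma sum_gamMix_mul (g : Ten2 n) (ε : ℝ) (u f : Vec n) (μ : Fin n) :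
    ∑ κ, gamMix g ε u κ μ * f κ = f μ - ε * lower g u μ * ∑ κ, u κ * f κ := by
  simp only [gamMix, sub_mul, Finset.sum_sub_distrib, ite_mul, one_mul, zero_mul,
    Finset.sum_ite_eq', Finset.mem_univ, if_true, Finset.mul_sum]
  congr 1
  exact Finset.sum_congr rfl fun κ _ => by ring

lemma sum_mul_gamMix (g : Ten2 n) (ε : ℝ) (u f : Vec n) (κ : Fin n) :
    ∑ μ, f μ * gamMix g ε u κ μ = f κ - ε * u κ * ∑ μ, f μ * lower g u μ := by
  simp only [gamMix, mul_sub, Finset.sum_sub_distrib, mul_ite, mul_one, mul_zero,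
    Finset.sum_ite_eq, Finset.mem_univ, if_true, Finset.mul_sum]
  congr 1
  exact Finset.sum_congr rfl fun κ _ => by ring

lemma sum_ginv_mul_lower {g ginv : Ten2 n} (hg : GoodMetric g ginv) (u : Vec n) (α : Fin n) :
    ∑ μ, ginv α μ * lower g u μ = u α := by
  simp only [lower, Finset.mul_sum]
  rw [Finset.sum_comm]
  simp only [← mul_assoc, ← Finset.sum_mul, hg.2.2.1, ite_mul, one_mul, zero_mul,
    Finset.sum_ite_eq, Finset.mem_univ, if_true]

lemma sum_mul_lower {g : Ten2 n} {ε : ℝ} {u : Vec n} (hu : UnitVec g ε u) :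
    ∑ α, u α * lower g u α = ε := by
  rw [← hu.2]
  simp only [lower, Finset.mul_sum]
  exact Finset.sum_congr rfl fun α _ => Finset.sum_congr rfl fun β _ => by ring

lemma UnitVec.mul_self {g : Ten2 n} {ε : ℝ} {u : Vec n} (hu : UnitVec g ε u) : ε * ε = 1 := by
  rcases hu.1 with h | h <;> rw [h] <;> norm_num

lemma gamUp_symm {g ginv : Ten2 n} (hg : GoodMetric g ginv) (ε : ℝ) (u : Vec n) (α β : Fin n) :
    gamUp ginv ε u α β = gamUp ginv ε u β α := by
  simp only [gamUp, hg.2.1 α β]; ring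

lemma sum_gamUp_mul_lower {g ginv : Ten2 n} (hg : GoodMetric g ginv) {ε : ℝ} {u : Vec n}
    (hu : UnitVec g ε u) (α : Fin n) : ∑ μ, gamUp ginv ε u α μ * lower g u μ = 0 := by
  simp only [gamUp, sub_mul, Finset.sum_sub_distrib, sum_ginv_mul_lower hg, mul_assoc,
    ← Finset.mul_sum, sum_mul_lower hu]
  linear_combination (- u α) * hu.mul_self

lemma sum_gamUp_mul_gamMix {g ginv : Ten2 n} (hg : GoodMetric g ginv) {ε : ℝ} {u : Vec n}
    (hu : UnitVec g ε u) (α κ : Fin n) :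
    ∑ μ, gamUp ginv ε u α μ * gamMix g ε u κ μ = gamUp ginv ε u α κ := by
  rw [sum_mul_gamMix, sum_gamUp_mul_lower hg hu]; ring

lemma sum_ginv_mul_gamMix_mul_gamMix {g ginv : Ten2 n} (hg : GoodMetric g ginv) {ε : ℝ}
    {u : Vec n} (hu : UnitVec g ε u) (ρ κ : Fin n) :
    ∑ α, ∑ μ, ginv α μ * (gamMix g ε u ρ α * gamMix g ε u κ μ) = gamUp ginv ε u ρ κ := by
  have h (α : Fin n) : ∑ μ, ginv α μ * (gamMix g ε u ρ α * gamMix g ε u κ μ) =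
      gamUp ginv ε u κ α * gamMix g ε u ρ α := by
    have h' := sum_mul_gamMix g ε u (ginv α) κ
    rw [sum_ginv_mul_lower hg] at h'
    calc _ = gamMix g ε u ρ α * ∑ μ, ginv α μ * gamMix g ε u κ μ := by
          rw [Finset.mul_sum]; exact Finset.sum_congr rfl fun μ _ => by ring
      _ = _ := by rw [h', gamUp, hg.2.1 κ α]; ring
  simp only [h, sum_gamUp_mul_gamMix hg hu, gamUp_symm hg ε u κ ρ]

lemma s2par_apply (g : Ten2 n) (ε : ℝ) (u : Vec n) (S : Ten2 n) (β ν : Fin n) :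
    s2par g ε u S β ν = S β ν - ε * lower g u β * ∑ ρ, u ρ * S ρ ν
      - ε * lower g u ν * ∑ κ, u κ * S β κ
      + ε * ε * lower g u β * lower g u ν * s2perp u S := by
  have h : s2par g ε u S β ν =
      ∑ ρ, gamMix g ε u ρ β * ∑ κ, gamMix g ε u κ ν * S ρ κ := by
    simp only [s2par, Finset.mul_sum, mul_assoc]
  have h' : s2perp u S = ∑ ρ, u ρ * ∑ κ, u κ * S ρ κ := by
    simp only [s2perp, Finset.mul_sum, mul_assoc]
  simp only [h, h', sum_gamMix_mul, mul_sub, Finset.sum_sub_distrib]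
  have h'' : ∑ ρ, u ρ * (ε * lower g u ν * ∑ κ, u κ * S ρ κ) =
      ε * lower g u ν * ∑ ρ, u ρ * ∑ κ, u κ * S ρ κ := by
    rw [Finset.mul_sum]; exact Finset.sum_congr rfl fun ρ _ => by ring
  rw [h'']; ring

lemma sum_gamUp_mul (ginv : Ten2 n) (ε : ℝ) (u : Vec n) (T : Ten4 n) (σ δ : Fin n) :
    ∑ ρ, ∑ κ, gamUp ginv ε u ρ κ * T ρ σ κ δ = RicT ginv T σ δ - ε * perp u T σ δ := by
  simp only [gamUp, RicT, perp, sub_mul, Finset.sum_sub_distrib, Finset.mul_sum, mul_assoc]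

/-- The Ricci-type trace of `T^∥` is the projection of `Ric(T) - ε T^⊥`. -/
lemma RicT_par4 {g ginv : Ten2 n} (hg : GoodMetric g ginv) {ε : ℝ} {u : Vec n}
    (hu : UnitVec g ε u) (T : Ten4 n) (β ν : Fin n) :
    RicT ginv (par4 g ε u T) β ν =
      s2par g ε u (fun σ δ => RicT ginv T σ δ - ε * perp u T σ δ) β ν := by
  simp only [← sum_gamUp_mul, ← sum_ginv_mul_gamMix_mul_gamMix hg hu, s2par]
  simp only [RicT, par4, Finset.mul_sum, Finset.sum_mul]
  rw [sum_six_reorder]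
  refine Finset.sum_congr rfl fun _ _ => Finset.sum_congr rfl fun _ _ =>
    Finset.sum_congr rfl fun _ _ => Finset.sum_congr rfl fun _ _ =>
    Finset.sum_congr rfl fun _ _ => Finset.sum_congr rfl fun _ _ => by ring

lemma sum_mul_perp {T : Ten4 n} (hT : IsRiemannType T) (u : Vec n) (ν : Fin n) :
    ∑ β, u β * perp u T β ν = 0 := by
  have h : ∑ β, u β * perp u T β ν = - ∑ β, u β * perp u T β ν := by
    conv_lhs => simp only [perp, Finset.mul_sum]
    rw [Finset.sum_comm]
    simp only [perp, Finset.mul_sum, ← Finset.sum_neg_distrib]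
    refine Finset.sum_congr rfl fun α _ => Finset.sum_congr rfl fun β _ =>
      Finset.sum_congr rfl fun μ _ => ?_
    rw [hT.2.1 β α]; ring
  linarith

lemma perp_symm {T : Ten4 n} (hT : IsRiemannType T) (u : Vec n) (β ν : Fin n) :
    perp u T β ν = perp u T ν β := by
  simp only [perp]
  rw [Finset.sum_comm]
  refine Finset.sum_congr rfl fun α _ => Finset.sum_congr rfl fun μ _ => ?_
  rw [hT.2.2.1 μ]; ring

lemma RicT_symm {g ginv : Ten2 n} (hg : GoodMetric g ginv) {T : Ten4 n} (hT : IsRiemannType T)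
    (β ν : Fin n) : RicT ginv T β ν = RicT ginv T ν β := by
  simp only [RicT]
  rw [Finset.sum_comm]
  refine Finset.sum_congr rfl fun α _ => Finset.sum_congr rfl fun μ _ => ?_
  rw [hT.2.2.1 μ, hg.2.1 μ]

lemma s2perp_eq (u : Vec n) (S : Ten2 n) : s2perp u S = ∑ ν, u ν * ∑ ρ, u ρ * S ρ ν := by
  simp only [s2perp, Finset.mul_sum]
  rw [Finset.sum_comm]
  exact Finset.sum_congr rfl fun α _ => Finset.sum_congr rfl fun β _ => by ring

lemma trGam_eq (ginv : Ten2 n) (ε : ℝ) (u : Vec n) (S : Ten2 n) :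
    trGam ginv ε u S = ∑ β, ∑ ν, ginv β ν * S β ν - ε * s2perp u S := by
  simp only [trGam, gamUp, s2perp, sub_mul, Finset.sum_sub_distrib, Finset.mul_sum, mul_assoc]

lemma s2perp_perp {T : Ten4 n} (hT : IsRiemannType T) (u : Vec n) :
    s2perp u (perp u T) = 0 := by
  simp [s2perp_eq, sum_mul_perp hT]

lemma sum_ginv_mul_perp {T : Ten4 n} (hT : IsRiemannType T) (ginv : Ten2 n) (u : Vec n) :
    ∑ β, ∑ ν, ginv β ν * perp u T β ν = s2perp u (RicT ginv T) := by
  simp only [perp, s2perp, RicT, Finset.mul_sum]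
  rw [sum_four_reorder]
  refine Finset.sum_congr rfl fun α _ => Finset.sum_congr rfl fun μ _ =>
    Finset.sum_congr rfl fun β _ => Finset.sum_congr rfl fun ν _ => ?_
  rw [hT.1 α β, hT.2.1 α β]; ring

lemma Ztr_eq {T : Ten4 n} (hT : IsRiemannType T) (ginv : Ten2 n) (ε : ℝ) (u : Vec n) :
    Ztr ginv ε u T = s2perp u (RicT ginv T) := by
  rw [Ztr, trGam_eq, s2perp_perp hT, sum_ginv_mul_perp hT]; ring

lemma RicT_par4_apply {g ginv : Ten2 n} (hg : GoodMetric g ginv) {ε : ℝ} {u : Vec n}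
    (hu : UnitVec g ε u) {T : Ten4 n} (hT : IsRiemannType T) (β ν : Fin n) :
    RicT ginv (par4 g ε u T) β ν = RicT ginv T β ν - ε * perp u T β ν
      - ε * lower g u β * ∑ ρ, u ρ * RicT ginv T ρ ν
      - ε * lower g u ν * ∑ ρ, u ρ * RicT ginv T ρ β
      + lower g u β * lower g u ν * s2perp u (RicT ginv T) := by
  have h (δ : Fin n) : ∑ ρ, u ρ * (RicT ginv T ρ δ - ε * perp u T ρ δ) =
      ∑ ρ, u ρ * RicT ginv T ρ δ := by
    simp only [mul_sub, Finset.sum_sub_distrib, mul_left_comm _ ε, ← Finset.mul_sum,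
      sum_mul_perp hT, mul_zero, sub_zero]
  rw [RicT_par4 hg hu, s2par_apply, s2perp_eq, s2perp_eq]
  simp only [h, RicT_symm hg hT β, perp_symm hT u β, hu.mul_self, one_mul]

lemma Vtr_eq {g ginv : Ten2 n} (hg : GoodMetric g ginv) {ε : ℝ} {u : Vec n}
    (hu : UnitVec g ε u) {T : Ten4 n} (hT : IsRiemannType T) (ν : Fin n) :
    Vtr g ginv ε u T ν = - ∑ ρ, u ρ * RicT ginv T ρ ν
      + ε * lower g u ν * s2perp u (RicT ginv T) := by
  have h (σ : Fin n) : ∑ ρ, u ρ * ∑ α, ∑ κ, gamUp ginv ε u α κ * T ρ α κ σ =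
      - ∑ ρ, u ρ * RicT ginv T ρ σ := by
    have h' (ρ : Fin n) : ∑ α, ∑ κ, gamUp ginv ε u α κ * T ρ α κ σ =
        - (RicT ginv T ρ σ - ε * perp u T ρ σ) := by
      simp only [← sum_gamUp_mul, hT.2.1 ρ, mul_neg, Finset.sum_neg_distrib]
    simp only [h', mul_neg, mul_sub, Finset.sum_neg_distrib, Finset.sum_sub_distrib,
      mul_left_comm _ ε, ← Finset.mul_sum, sum_mul_perp hT, mul_zero, sub_zero]
  have h' : Vtr g ginv ε u T ν = ∑ σ, gamMix g ε u σ ν *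
      ∑ ρ, u ρ * ∑ α, ∑ κ, gamUp ginv ε u α κ * T ρ α κ σ := by
    simp only [Vtr, perppar, Finset.mul_sum]
    rw [sum_five_reorder]
    refine Finset.sum_congr rfl fun σ _ => Finset.sum_congr rfl fun ρ _ =>
      Finset.sum_congr rfl fun α _ => Finset.sum_congr rfl fun κ _ => ?_
    rw [← sum_gamUp_mul_gamMix hg hu α κ]
    simp only [Finset.mul_sum, Finset.sum_mul]
    exact Finset.sum_congr rfl fun β _ => by ring
  rw [h', sum_gamMix_mul]
  simp only [h, mul_neg, Finset.sum_neg_distrib, ← s2perp_eq]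
  ring

lemma sum_mul_RicT_par4 {g ginv : Ten2 n} (hg : GoodMetric g ginv) {ε : ℝ} {u : Vec n}
    (hu : UnitVec g ε u) {T : Ten4 n} (hT : IsRiemannType T) (ν : Fin n) :
    ∑ β, u β * RicT ginv (par4 g ε u T) β ν = 0 := by
  have h1 : ∑ β, u β * (ε * lower g u β * ∑ ρ, u ρ * RicT ginv T ρ ν) =
      (∑ β, u β * lower g u β) * (ε * ∑ ρ, u ρ * RicT ginv T ρ ν) := by
    rw [Finset.sum_mul]; exact Finset.sum_congr rfl fun β _ => by ring
  have h2 : ∑ β, u β * (ε * lower g u ν * ∑ ρ, u ρ * RicT ginv T ρ β) =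
      ε * lower g u ν * s2perp u (RicT ginv T) := by
    rw [s2perp_eq, Finset.mul_sum]; exact Finset.sum_congr rfl fun β _ => by ring
  have h3 : ∑ β, u β * (lower g u β * lower g u ν * s2perp u (RicT ginv T)) =
      (∑ β, u β * lower g u β) * (lower g u ν * s2perp u (RicT ginv T)) := by
    rw [Finset.sum_mul]; exact Finset.sum_congr rfl fun β _ => by ring
  have h4 : ∑ β, u β * (ε * perp u T β ν) = 0 := by
    simp only [mul_left_comm _ ε, ← Finset.mul_sum, sum_mul_perp hT, mul_zero]
  simp only [RicT_par4_apply hg hu hT, mul_sub, mul_add, Finset.sum_sub_distrib,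
    Finset.sum_add_distrib, h1, h2, h3, h4, sum_mul_lower hu]
  linear_combination (- ∑ ρ, u ρ * RicT ginv T ρ ν) * hu.mul_self

lemma sum_ginv_mul_lower_mul {g ginv : Ten2 n} (hg : GoodMetric g ginv) (u f : Vec n) :
    ∑ β, ∑ ν, ginv β ν * (lower g u ν * f β) = ∑ β, u β * f β := by
  simp only [← mul_assoc, ← Finset.sum_mul, sum_ginv_mul_lower hg]

lemma ScalT_par4 {g ginv : Ten2 n} (hg : GoodMetric g ginv) {ε : ℝ} {u : Vec n}
    (hu : UnitVec g ε u) {T : Ten4 n} (hT : IsRiemannType T) :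
    ScalT ginv (par4 g ε u T) = ScalT ginv T - 2 * ε * s2perp u (RicT ginv T) := by
  set r := s2perp u (RicT ginv T) with hr
  have h1 : ∑ β, ∑ ν, ginv β ν * (ε * lower g u ν * ∑ ρ, u ρ * RicT ginv T ρ β) = ε * r := by
    rw [hr, s2perp_eq, ← sum_ginv_mul_lower_mul hg]
    simp only [Finset.mul_sum (s := Finset.univ) (a := ε)]
    exact Finset.sum_congr rfl fun β _ => Finset.sum_congr rfl fun ν _ => by ring
  have h2 : ∑ β, ∑ ν, ginv β ν * (ε * lower g u β * ∑ ρ, u ρ * RicT ginv T ρ ν) = ε * r := by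
    rw [← h1, Finset.sum_comm]
    exact Finset.sum_congr rfl fun β _ => Finset.sum_congr rfl fun ν _ => by rw [hg.2.1 ν]
  have h3 : ∑ β, ∑ ν, ginv β ν * (lower g u β * lower g u ν * r) = ε * r := by
    have h := sum_ginv_mul_lower_mul hg u (fun β => lower g u β * r)
    simp only [← mul_assoc, ← Finset.sum_mul, sum_mul_lower hu] at h
    rw [← h]
    simp only [Finset.sum_mul]
    exact Finset.sum_congr rfl fun β _ => Finset.sum_congr rfl fun ν _ => by ring
  have h4 : ∑ β, ∑ ν, ginv β ν * (ε * perp u T β ν) = ε * r := by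
    simp only [mul_left_comm _ ε, ← Finset.mul_sum, sum_ginv_mul_perp hT, hr]
  rw [ScalT]
  simp only [RicT_par4_apply hg hu hT, mul_sub, mul_add, Finset.sum_sub_distrib,
    Finset.sum_add_distrib]
  rw [h1, h2, h3, h4, ScalT]
  ring

/-- Proposition `DecomSchWeyl-type`, Schouten part: decomposition of
`Sch(T)` with respect to `u`. -/
theorem stmt5 {n : ℕ} (hn : 4 ≤ n) (g ginv : Ten2 n) (hg : GoodMetric g ginv)
    (ε : ℝ) (u : Vec n) (hu : UnitVec g ε u)
    (T : Ten4 n) (hT : IsRiemannType T) :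
    ∀ β ν, SchT g ginv T β ν =
      (1 / ((n : ℝ) - 2)) * (ε * hatPerp g ginv ε u T β ν
        + hat2 g ginv ε u (RicT ginv (par4 g ε u T)) β ν)
      + ScalT ginv (par4 g ε u T) / (2 * ((n : ℝ) - 1) * ((n : ℝ) - 2)) * gam g ε u β ν
      - (2 * ε / ((n : ℝ) - 2)) *
          ((lower g u β * Vtr g ginv ε u T ν + lower g u ν * Vtr g ginv ε u T β) / 2)
      + (1 / ((n : ℝ) - 1)) *
          (Ztr ginv ε u T - ε * ScalT ginv (par4 g ε u T) / (2 * ((n : ℝ) - 2))) *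
          (lower g u β * lower g u ν) := by
  intro β ν
  have hn' : (4 : ℝ) ≤ n := by exact_mod_cast hn
  have h1 : (n : ℝ) - 1 ≠ 0 := by linarith
  have h2 : (n : ℝ) - 2 ≠ 0 := by linarith
  have htr : trGam ginv ε u (RicT ginv (par4 g ε u T)) = ScalT ginv (par4 g ε u T) := by
    simp only [trGam_eq, s2perp_eq, sum_mul_RicT_par4 hg hu hT, mul_zero, Finset.sum_const_zero,
      sub_zero, ScalT]
  have hZ : trGam ginv ε u (perp u T) = s2perp u (RicT ginv T) := Ztr_eq hT ginv ε u
  simp only [SchT, hatPerp, hat2, htr, hZ, Ztr_eq hT, Vtr_eq hg hu hT, ScalT_par4 hg hu hT,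
    RicT_par4_apply hg hu hT, gam]
  generalize s2perp u (RicT ginv T) = r
  rw [← sub_eq_zero]
  transitivity lower g u β * lower g u ν * r *
    (2 / ((n : ℝ) - 2) - 1 / (((n : ℝ) - 1) * ((n : ℝ) - 2))) * (ε * ε - 1)
  · field_simp
    ring
  · rw [hu.mul_self]; ring

end Decomp
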